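/- Let ν ∈ P(S) satisfy I(ν) < ∞, and let q(x,·) = α(x,·) + ρ(x)δ_x(·) (ν-a.s., with α(x,·) ≪ a(x,·) ν-a.s. and ρ measurable) be a transition kernel with invariant measure ν attaining I(ν) = ∫_S R(q(x,·) ‖ K(x,·)) ν(dx). Then, writing α(x,y) and a(x,y) for the Lebesgue densities of α(x,·) and a(x,·), the rate function can be expressed as I(ν) = ∫_S ∫_S log(α(x,y)/a(x,y)) α(x,y) dy ν(dx) + ∫_S log(ρ(x)/r(x)) ρ(x) ν(dx). -/

import Mathlib

open MeasureTheory ProbabilityTheory Filter Set Metric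
open scoped ENNReal NNReal Topology

noncomputable section

namespace MHLDP

variable {α : Type*}

open Classical in
/-- Relative entropy `R(μ‖ν) = ∫ log (dμ/dν) dμ` if `μ ≪ ν` (and the integral exists),
`+∞` otherwise. -/
def relEnt [MeasurableSpace α] (μ ν : Measure α) : ℝ≥0∞ :=
  if μ ≪ ν ∧ Integrable (fun x => Real.log ((μ.rnDeriv ν x).toReal)) μ
  then ENNReal.ofReal (∫ x, Real.log ((μ.rnDeriv ν x).toReal) ∂μ)
  else ⊤

variable {d : ℕ} {S : Set (EuclideanSpace ℝ (Fin d))}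

/-- Lebesgue measure on (the subtype) `S ⊆ ℝ^d`. -/
def leb (S : Set (EuclideanSpace ℝ (Fin d))) : Measure S :=
  Measure.comap Subtype.val volume

/-- The Hastings ratio `min{1, π(y)J(x|y)/(π(x)J(y|x))}`, set to `1` when
`π(x)J(y|x) = 0`.  Here `Jd x y` denotes the density `J(y|x)`. -/
def hastingsRatio (πd : S → ℝ) (Jd : S → S → ℝ) (x y : S) : ℝ :=
  if πd x * Jd x y = 0 then 1 else min 1 ((πd y * Jd y x) / (πd x * Jd x y))

/-- The Lebesgue density `a(x,y)` of the acceptance part of the MH kernel. -/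
def accDens (πd : S → ℝ) (Jd : S → S → ℝ) (x y : S) : ℝ :=
  hastingsRatio πd Jd x y * Jd x y

/-- The acceptance sub-probability kernel `a(x,dy)`. -/
def acc (πd : S → ℝ) (Jd : S → S → ℝ) (x : S) : Measure S :=
  (leb S).withDensity (fun y => ENNReal.ofReal (accDens πd Jd x y))

/-- The rejection probability `r(x) = 1 - a(x,S)`. -/
def rej (πd : S → ℝ) (Jd : S → S → ℝ) (x : S) : ℝ :=
  1 - (acc πd Jd x Set.univ).toReal

/-- The Metropolis–Hastings transition kernel `K(x,dy) = a(x,dy) + r(x) δ_x(dy)`. -/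
def mhK (πd : S → ℝ) (Jd : S → S → ℝ) (x : S) : Measure S :=
  acc πd Jd x + ENNReal.ofReal (rej πd Jd x) • Measure.dirac x

/-- `μ` is an invariant measure for the transition kernel `q`. -/
def Invariant [MeasurableSpace α] (μ : Measure α) (q : α → Measure α) : Prop :=
  ∀ A : Set α, MeasurableSet A → μ A = ∫⁻ x, q x A ∂μ

/-- The rate function `I(ν) = inf_q ∫ R(q(x,·) ‖ K(x,·)) ν(dx)`, infimum over Markov
transition kernels `q` with invariant measure `ν`. -/
def rateI [MeasurableSpace α] (K : α → Measure α) (ν : Measure α) : ℝ≥0∞ :=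
  ⨅ (q : Kernel α α) (_ : IsMarkovKernel q) (_ : Invariant ν (fun x => q x)),
    ∫⁻ x, relEnt (q x) (K x) ∂ν

/-- The joint measure `(μ ⊗ K)(dx dy) = μ(dx) K(x,dy)` on `S × S`. -/
def prodK [MeasurableSpace α] (μ : Measure α) (K : α → Measure α) : Measure (α × α) :=
  μ.bind fun x => (K x).map fun y => (x, y)

/-- The rate function `I(μ) = inf_{γ ∈ A(μ)} R(γ ‖ μ ⊗ K)`, infimum over probability
measures on `S × S` with both marginals equal to `μ`. -/
def rateEmp [MeasurableSpace α] (K : α → Measure α) (μ : Measure α) : ℝ≥0∞ :=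
  ⨅ (γ : Measure (α × α)) (_ : IsProbabilityMeasure γ)
    (_ : γ.map Prod.fst = μ) (_ : γ.map Prod.snd = μ), relEnt γ (prodK μ K)

/-- Assumptions (A.1) and (A.2): `π` is a probability measure on `S` with continuous
density `πd` w.r.t. Lebesgue measure, equivalent to Lebesgue measure; the proposal
distributions `J(·|x)` are probability measures with jointly continuous, bounded,
strictly positive density `Jd x · = J(·|x)`, absolutely continuous w.r.t. `π`. -/
structure Assumptions (πd : S → ℝ) (Jd : S → S → ℝ) (π : Measure S) : Prop where
  measS : MeasurableSet S
  prob_pi : IsProbabilityMeasure π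
  pi_nonneg : ∀ x, 0 ≤ πd x
  pi_dens : π = (leb S).withDensity (fun x => ENNReal.ofReal (πd x))
  pi_cont : Continuous πd
  pi_ac : π ≪ leb S
  leb_ac : leb S ≪ π
  J_nonneg : ∀ x y, 0 ≤ Jd x y
  J_dens_prob : ∀ x, IsProbabilityMeasure ((leb S).withDensity (fun y => ENNReal.ofReal (Jd x y)))
  J_ac_pi : ∀ x, (leb S).withDensity (fun y => ENNReal.ofReal (Jd x y)) ≪ π
  J_cont : Continuous (fun p : S × S => Jd p.1 p.2)
  J_bdd : ∃ C : ℝ, ∀ x y, Jd x y ≤ C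
  J_pos : ∀ x y, 0 < Jd x y

/-- Assumption (A.3): existence of a Lyapunov function `U` for the kernel `K`. -/
structure Lyapunov (K : S → Measure S) (U : S → ℝ) : Prop where
  nonneg : ∀ x, 0 ≤ U x
  lb : ∃ M : ℝ, ∀ x, (M : EReal) ≤ (U x : EReal)
        - ENNReal.log (∫⁻ y, ENNReal.ofReal (Real.exp (U y)) ∂(K x))
  cpt : ∀ M : ℝ, IsCompact (closure {x : S | (U x : EReal)
        - ENNReal.log (∫⁻ y, ENNReal.ofReal (Real.exp (U y)) ∂(K x)) ≤ (M : EReal)})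
  bdd_on_cpt : ∀ C : Set S, IsCompact C → ∃ B : ℝ, ∀ x ∈ C, U x ≤ B

/-- The law of `(X_0, …, X_n)` for the Markov chain with transition kernel `K`
started at `x`. -/
def chainLaw [MeasurableSpace α] (K : α → Measure α) (x : α) : (n : ℕ) → Measure (Fin (n + 1) → α)
  | 0 => Measure.dirac (fun _ => x)
  | (n + 1) => (chainLaw K x n).bind (fun p => (K (p (Fin.last n))).map (fun y => Fin.snoc p y))

/-- The empirical measure of a finite path. -/
def empMeas [MeasurableSpace α] {n : ℕ} (p : Fin (n + 1) → α) : Measure α :=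
  ((n : ℝ≥0∞) + 1)⁻¹ • ∑ i : Fin (n + 1), Measure.dirac (p i)

lemma empMeas_isProbabilityMeasure [MeasurableSpace α] {n : ℕ} (p : Fin (n + 1) → α) :
    IsProbabilityMeasure (empMeas p) := by
  constructor
  simp only [empMeas, Measure.smul_apply, Measure.finset_sum_apply, measure_univ, smul_eq_mul]
  rw [Finset.sum_const, Finset.card_univ, Fintype.card_fin, nsmul_eq_mul, mul_one]
  rw [show ((n + 1 : ℕ) : ℝ≥0∞) = (n : ℝ≥0∞) + 1 by push_cast; ring]
  exact ENNReal.inv_mul_cancel (by simp) (by finiteness)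

/-- The empirical measure of a finite path, as a probability measure. -/
def empProb [MeasurableSpace α] {n : ℕ} (p : Fin (n + 1) → α) : ProbabilityMeasure α :=
  ⟨empMeas p, empMeas_isProbabilityMeasure p⟩

end MHLDP

namespace MHLDP

variable {α : Type*} {d : ℕ} {S : Set (EuclideanSpace ℝ (Fin d))}

/-- The `k`-step transition probabilities of the kernel `K`. -/
def kIter [MeasurableSpace α] (K : α → Measure α) : ℕ → α → Measure α
  | 0, x => Measure.dirac x
  | (n + 1), x => (kIter K n x).bind K

/-- Ergodicity of the stationary Markov chain with initial (invariant) distribution `μ` and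
transition kernel `q`: every a.s. invariant set is trivial. -/
def KernelErgodic [MeasurableSpace α] (μ : Measure α) (q : α → Measure α) : Prop :=
  Invariant μ q ∧ ∀ A : Set α, MeasurableSet A →
    (∀ᵐ x ∂μ, x ∈ A → q x A = 1) → μ A = 0 ∨ μ A = 1

/-- The set `S₊ = {x ∈ S : π(x) > 0}`. -/
def Splus (πd : S → ℝ) : Set S := {x | 0 < πd x}

/-- The modulus `Δ_ε(x)` of the ball-smoothing construction. -/
def Delta (πd : S → ℝ) (Jd : S → S → ℝ) (ε : ℝ) (x : S) : ℝ :=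
  sSup {t : ℝ | ∀ y z : S, dist y x < t → dist z x < t →
    |Real.log (accDens πd Jd x x) - Real.log (accDens πd Jd y z)| < ε ∧
    |Real.log (rej πd Jd x) - Real.log (rej πd Jd y)| < ε}

/-- The random radius `ϱ^n` of the ball-smoothing construction, given the sample points `Y`. -/
def rad (πd : S → ℝ) (Jd : S → S → ℝ) (n : ℕ) (Y : ℕ → S) : ℝ :=
  sInf ({1 / (n : ℝ)}
    ∪ (Set.range fun i : Fin n => Delta πd Jd (1 / (n : ℝ)) (Y (i : ℕ)))
    ∪ {t : ℝ | ∃ i j : Fin n, Y (i : ℕ) ≠ Y (j : ℕ) ∧ t = dist (Y (i : ℕ)) (Y (j : ℕ)) / 2}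
    ∪ (Set.range fun i : Fin n =>
        Metric.infDist ((Y (i : ℕ) : EuclideanSpace ℝ (Fin d))) (frontier S) / 2)
    ∪ (Set.range fun i : Fin n => accDens πd Jd (Y (i : ℕ)) (Y (i : ℕ))))

/-- The volume `V_n = λ(B_{ϱ^n}(0))`. -/
def Vn (πd : S → ℝ) (Jd : S → S → ℝ) (n : ℕ) (Y : ℕ → S) : ℝ≥0∞ :=
  volume (Metric.ball (0 : EuclideanSpace ℝ (Fin d)) (rad πd Jd n Y))

/-- The smoothed random measure `ν_s^n(dx) = (1/(n V_n)) Σ_{i<n} 1{x ∈ B_{ϱ^n}(Y_i)} λ(dx)`. -/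
def smooth (πd : S → ℝ) (Jd : S → S → ℝ) (n : ℕ) (Y : ℕ → S) : Measure S :=
  ((n : ℝ≥0∞) * Vn πd Jd n Y)⁻¹ •
    (leb S).withDensity (fun x =>
      ∑ i : Fin n, if dist x (Y (i : ℕ)) < rad πd Jd n Y then (1 : ℝ≥0∞) else 0)

end MHLDP

namespace MHLDP

section Entropy

variable {X : Type*} [MeasurableSpace X]

lemma llr_restrict_ae_eq {μ ν : Measure X} [IsFiniteMeasure μ] [IsFiniteMeasure ν]
    (hμν : μ ≪ ν) {s : Set X} (hs : MeasurableSet s) :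
    llr μ ν =ᵐ[μ.restrict s] llr (μ.restrict s) (ν.restrict s) := by
  have h1 : μ.restrict s = (ν.restrict s).withDensity (μ.rnDeriv ν) := by
    rw [← restrict_withDensity hs, Measure.withDensity_rnDeriv_eq _ _ hμν]
  have h2 : (μ.restrict s).rnDeriv (ν.restrict s) =ᵐ[ν.restrict s] μ.rnDeriv ν := by
    conv_lhs => rw [h1]
    exact Measure.rnDeriv_withDensity _ (Measure.measurable_rnDeriv _ _)
  filter_upwards [(hμν.restrict s).ae_le h2] with y hy
  simp only [llr, hy]

/-- Chain rule for the relative entropy of measures split into a part without mass at `x` and a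
multiple of `dirac x`. -/
lemma integral_llr_add_smul_dirac [MeasurableSingletonClass X] {μ ν : Measure X}
    [IsFiniteMeasure μ] [IsFiniteMeasure ν] (hμν : μ ≪ ν) {x : X} (hx : ν {x} = 0)
    {ρ r : ℝ} (hρ : 0 ≤ ρ) (hr : 0 ≤ r)
    (hac : μ + ENNReal.ofReal ρ • Measure.dirac x ≪ ν + ENNReal.ofReal r • Measure.dirac x)
    (hint : Integrable
      (llr (μ + ENNReal.ofReal ρ • Measure.dirac x) (ν + ENNReal.ofReal r • Measure.dirac x))
      (μ + ENNReal.ofReal ρ • Measure.dirac x)) :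
    Integrable (llr μ ν) μ ∧
    ∫ y, llr (μ + ENNReal.ofReal ρ • Measure.dirac x)
        (ν + ENNReal.ofReal r • Measure.dirac x) y ∂(μ + ENNReal.ofReal ρ • Measure.dirac x) =
      ∫ y, llr μ ν y ∂μ + Real.log (ρ / r) * ρ := by
  have hrestrict : ∀ (τ : Measure X) (c : ℝ≥0∞), τ {x} = 0 →
      (τ + c • Measure.dirac x).restrict {x}ᶜ = τ := by
    intro τ c hτ
    classical
    rw [Measure.restrict_add, Measure.restrict_smul,
      restrict_dirac' (measurableSet_singleton x).compl]
    simp only [mem_compl_iff, mem_singleton_iff, not_true_eq_false, if_false, smul_zero, add_zero]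
    exact Measure.restrict_eq_self_of_ae_mem (by
      rw [ae_iff]; simpa using hτ)
  have hμx := hμν hx
  set Q := μ + ENNReal.ofReal ρ • Measure.dirac x with hQ
  set K := ν + ENNReal.ofReal r • Measure.dirac x with hK
  have : IsFiniteMeasure Q := by
    have := Measure.smul_finite (Measure.dirac x) (ENNReal.ofReal_ne_top (r := ρ)); infer_instance
  have : IsFiniteMeasure K := by
    have := Measure.smul_finite (Measure.dirac x) (ENNReal.ofReal_ne_top (r := r)); infer_instance
  have hae : llr Q K =ᵐ[μ] llr μ ν := by
    have := llr_restrict_ae_eq hac (measurableSet_singleton x).compl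
    rwa [hrestrict μ _ hμx, hrestrict ν _ hx] at this
  have hintμ : Integrable (llr Q K) μ := hint.mono_measure (Measure.le_add_right le_rfl)
  refine ⟨hintμ.congr hae, ?_⟩
  have hpt : ENNReal.ofReal ρ = Q.rnDeriv K x * ENNReal.ofReal r := by
    have h := congrArg (fun τ => τ {x}) (Measure.withDensity_rnDeriv_eq _ _ hac)
    simp only [withDensity_apply _ (measurableSet_singleton x), lintegral_singleton] at h
    simpa [hQ, hK, hμx, hx] using h.symm
  have hint2 : Integrable (llr Q K) (ENNReal.ofReal ρ • Measure.dirac x) :=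
    hint.mono_measure (Measure.le_add_left le_rfl)
  have hsplit : ∫ y, llr Q K y ∂Q
      = ∫ y, llr Q K y ∂μ + ∫ y, llr Q K y ∂(ENNReal.ofReal ρ • Measure.dirac x) :=
    integral_add_measure hintμ hint2
  rw [hsplit, integral_congr_ae hae, integral_smul_measure, integral_dirac, ENNReal.toReal_ofReal hρ,
    smul_eq_mul, mul_comm ρ]
  rcases hρ.eq_or_lt with h0 | h0
  · simp [← h0]
  · have hp := congrArg ENNReal.toReal hpt
    rw [ENNReal.toReal_mul, ENNReal.toReal_ofReal hρ, ENNReal.toReal_ofReal hr] at hp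
    have hr0 : r ≠ 0 := by rintro rfl; simp at hp; exact h0.ne' hp
    rw [hp, mul_div_cancel_right₀ _ hr0, llr]

/-- The relative entropy written in terms of densities with respect to a reference measure. -/
lemma integral_log_div_mul_eq_integral_llr {μ l : Measure X} [IsFiniteMeasure μ] [SigmaFinite l]
    {f : X → ℝ} (hf : Measurable f) (hf0 : ∀ y, 0 ≤ f y)
    (hμ : μ ≪ l.withDensity fun y => ENNReal.ofReal (f y)) :
    ∫ y, Real.log ((μ.rnDeriv l y).toReal / f y) * (μ.rnDeriv l y).toReal ∂l
      = ∫ y, llr μ (l.withDensity fun y => ENNReal.ofReal (f y)) y ∂μ := by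
  have hμl : μ ≪ l := hμ.trans (withDensity_absolutelyContinuous _ _)
  set ν := l.withDensity fun y => ENNReal.ofReal (f y) with hν
  have : SigmaFinite ν := SigmaFinite.withDensity_ofReal _
  rw [← integral_toReal_rnDeriv_mul hμl]
  have h1 : μ = l.withDensity ((fun y => ENNReal.ofReal (f y)) * μ.rnDeriv ν) := by
    rw [withDensity_mul _ hf.ennreal_ofReal (Measure.measurable_rnDeriv _ _), ← hν,
      Measure.withDensity_rnDeriv_eq _ _ hμ]
  have h2 : μ.rnDeriv l =ᵐ[l] (fun y => ENNReal.ofReal (f y)) * μ.rnDeriv ν := by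
    conv_lhs => rw [h1]
    exact Measure.rnDeriv_withDensity _
      (hf.ennreal_ofReal.mul (Measure.measurable_rnDeriv _ _))
  refine integral_congr_ae ?_
  filter_upwards [h2] with y hy
  rw [hy, Pi.mul_apply, ENNReal.toReal_mul, ENNReal.toReal_ofReal (hf0 y), llr]
  rcases (hf0 y).eq_or_lt with h0 | h0
  · simp [← h0]
  · rw [mul_div_cancel_left₀ _ h0.ne', mul_comm]

lemma measurable_relEnt {Y : Type*} [MeasurableSpace Y]
    [MeasurableSpace.CountableOrCountablyGenerated Y X] (κ η : Kernel Y X) [IsFiniteKernel κ]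
    [IsFiniteKernel η] : Measurable fun x => relEnt (κ x) (η x) := by
  classical
  have hlog : Measurable (Function.uncurry fun x y => Real.log (κ.rnDeriv η x y).toReal) :=
    (Kernel.measurable_rnDeriv κ η).ennreal_toReal.log
  have hac := Kernel.measurableSet_absolutelyContinuous κ η
  have hint := measurableSet_kernel_integrable (κ := κ) hlog.stronglyMeasurable
  have hG := (hlog.stronglyMeasurable.integral_kernel_prod_right (κ := κ)).measurable.ennreal_ofReal
  have hite : Measurable fun x =>
      if κ x ≪ η x ∧ Integrable (fun y => Real.log (κ.rnDeriv η x y).toReal) (κ x)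
      then ENNReal.ofReal (∫ y, Real.log (κ.rnDeriv η x y).toReal ∂κ x) else ⊤ :=
    Measurable.ite (hac.inter hint) hG measurable_const
  convert hite using 2 with x
  by_cases h : κ x ≪ η x
  · have hae : (fun y => Real.log ((κ x).rnDeriv (η x) y).toReal)
        =ᵐ[κ x] fun y => Real.log (κ.rnDeriv η x y).toReal := by
      filter_upwards [h.ae_le (Kernel.rnDeriv_eq_rnDeriv_measure (κ := κ) (η := η) (a := x))]
        with y hy
      rw [hy]
    simp only [relEnt, h, integrable_congr hae, integral_congr_ae hae]
  · simp [relEnt, h]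

lemma toReal_relEnt {μ ν : Measure X} [IsProbabilityMeasure μ] [IsProbabilityMeasure ν]
    (h : relEnt μ ν ≠ ⊤) :
    μ ≪ ν ∧ Integrable (llr μ ν) μ ∧ (relEnt μ ν).toReal = ∫ y, llr μ ν y ∂μ := by
  by_cases hc : μ ≪ ν ∧ Integrable (fun x => Real.log ((μ.rnDeriv ν x).toReal)) μ
  · refine ⟨hc.1, hc.2, ?_⟩
    have h0 := InformationTheory.integral_llr_add_sub_measure_univ_nonneg hc.1 hc.2
    simp only [probReal_univ, add_sub_cancel_right] at h0
    rw [relEnt, if_pos hc]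
    exact ENNReal.toReal_ofReal h0
  · exact absurd (if_neg hc) h

lemma relEnt_self (μ : Measure X) [IsFiniteMeasure μ] : relEnt μ μ = 0 := by
  have h : (fun y => Real.log (μ.rnDeriv μ y).toReal) =ᵐ[μ] fun _ => 0 := by
    filter_upwards [Measure.rnDeriv_self μ] with y hy
    simp [hy]
  rw [relEnt, if_pos ⟨.rfl, (integrable_congr h).2 (integrable_const 0)⟩, integral_congr_ae h]
  simp

end Entropy

section MH
variable {d : ℕ} {S : Set (EuclideanSpace ℝ (Fin d))} {πd : S → ℝ} {Jd : S → S → ℝ}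
  {π : Measure S}

lemma sigmaFinite_leb (hS : MeasurableSet S) : SigmaFinite (leb S) := by
  have h : SigmaFinite ((leb S).map Subtype.val) := by
    rw [leb, (MeasurableEmbedding.subtype_coe hS).map_comap]
    infer_instance
  exact h.of_map _ measurable_subtype_coe.aemeasurable

lemma leb_singleton [NeZero d] (x : S) (hS : MeasurableSet S) : leb S {x} = 0 := by
  rw [leb, (MeasurableEmbedding.subtype_coe hS).comap_apply]
  simp

lemma accDens_nonneg (hA : Assumptions πd Jd π) (x y : S) : 0 ≤ accDens πd Jd x y := by
  have h1 := hA.pi_nonneg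
  have h2 := hA.J_nonneg
  unfold accDens hastingsRatio
  refine mul_nonneg ?_ (h2 x y)
  split_ifs
  · exact zero_le_one
  · exact le_min zero_le_one (div_nonneg (mul_nonneg (h1 y) (h2 y x)) (mul_nonneg (h1 x) (h2 x y)))

lemma accDens_le (hA : Assumptions πd Jd π) (x y : S) : accDens πd Jd x y ≤ Jd x y := by
  unfold accDens hastingsRatio
  refine mul_le_of_le_one_left (hA.J_nonneg x y) ?_
  split_ifs
  · exact le_rfl
  · exact min_le_left _ _

lemma measurable_accDens (hA : Assumptions πd Jd π) :
    Measurable (Function.uncurry (accDens πd Jd)) := by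
  have hJ : Measurable fun p : S × S => Jd p.1 p.2 := hA.J_cont.measurable
  have hJ' : Measurable fun p : S × S => Jd p.2 p.1 := hJ.comp measurable_swap
  have hp := hA.pi_cont.measurable
  have h1 : Measurable fun p : S × S => πd p.1 * Jd p.1 p.2 := (hp.comp measurable_fst).mul hJ
  have h2 : Measurable fun p : S × S => πd p.2 * Jd p.2 p.1 := (hp.comp measurable_snd).mul hJ'
  exact (Measurable.ite (h1 (measurableSet_singleton 0)) measurable_const
    (measurable_const.min (h2.div h1))).mul hJ

lemma acc_univ_le_one (hA : Assumptions πd Jd π) (x : S) : acc πd Jd x univ ≤ 1 := by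
  have := hA.J_dens_prob x
  rw [← measure_univ (μ := (leb S).withDensity fun y => ENNReal.ofReal (Jd x y))]
  exact withDensity_mono (ae_of_all _ fun y => ENNReal.ofReal_le_ofReal (accDens_le hA x y)) _

lemma isFiniteMeasure_acc (hA : Assumptions πd Jd π) (x : S) : IsFiniteMeasure (acc πd Jd x) :=
  ⟨(acc_univ_le_one hA x).trans_lt ENNReal.one_lt_top⟩

lemma rej_mem_Icc (hA : Assumptions πd Jd π) (x : S) : rej πd Jd x ∈ Icc (0 : ℝ) 1 := by
  have := ENNReal.toReal_mono ENNReal.one_ne_top (acc_univ_le_one hA x)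
  simp only [ENNReal.toReal_one] at this
  exact ⟨sub_nonneg.2 this, sub_le_self _ ENNReal.toReal_nonneg⟩

lemma isProbabilityMeasure_mhK (hA : Assumptions πd Jd π) (x : S) :
    IsProbabilityMeasure (mhK πd Jd x) := by
  have := isFiniteMeasure_acc hA x
  constructor
  simp only [mhK, Measure.add_apply, Measure.smul_apply, measure_univ, smul_eq_mul, mul_one, rej]
  rw [ENNReal.ofReal_sub _ ENNReal.toReal_nonneg, ENNReal.ofReal_one,
    ENNReal.ofReal_toReal (measure_ne_top _ _), add_tsub_cancel_of_le (acc_univ_le_one hA x)]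

lemma measurable_acc (hA : Assumptions πd Jd π) : Measurable (acc πd Jd) := by
  have := sigmaFinite_leb hA.measS
  have hm : Measurable (Function.uncurry fun x y => ENNReal.ofReal (accDens πd Jd x y)) :=
    (measurable_accDens hA).ennreal_ofReal
  have h := (Kernel.withDensity (Kernel.const S (leb S))
    fun x y => ENNReal.ofReal (accDens πd Jd x y)).measurable
  convert h using 1
  ext1 x
  rw [Kernel.withDensity_apply _ hm, Kernel.const_apply, acc]

lemma measurable_rej (hA : Assumptions πd Jd π) : Measurable (rej πd Jd) :=
  measurable_const.sub
    ((Measure.measurable_coe MeasurableSet.univ).comp (measurable_acc hA)).ennreal_toReal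

lemma measurable_mhK (hA : Assumptions πd Jd π) : Measurable (mhK πd Jd) := by
  refine Measure.measurable_of_measurable_coe _ fun s hs => ?_
  simp only [mhK, Measure.add_apply, Measure.smul_apply, smul_eq_mul]
  exact ((Measure.measurable_coe hs).comp (measurable_acc hA)).add
    ((measurable_rej hA).ennreal_ofReal.mul
      ((Measure.measurable_coe hs).comp Measure.measurable_dirac))

lemma neg_one_le_log_div_mul {ρ r : ℝ} (hρ : 0 ≤ ρ) (hr : r ∈ Icc (0 : ℝ) 1) :
    -1 ≤ Real.log (ρ / r) * ρ := by
  rcases hρ.eq_or_lt with rfl | hρ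
  · simp
  rcases hr.1.eq_or_lt with rfl | hr0
  · simp
  have h1 := Real.one_sub_inv_le_log_of_pos (div_pos hρ hr0)
  have h2 := mul_le_mul_of_nonneg_right h1 hρ.le
  have h3 : (1 - (ρ / r)⁻¹) * ρ = ρ - r := by field_simp
  linarith [hr.2]

/-- The absolutely continuous part of the rate function. -/
abbrev contPart (πd : S → ℝ) (Jd : S → S → ℝ) (αm : S → Measure S) (x : S) : ℝ :=
  ∫ y, Real.log ((((αm x).rnDeriv (leb S) y).toReal) / accDens πd Jd x y) *
    ((αm x).rnDeriv (leb S) y).toReal ∂(leb S)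

/-- Pointwise decomposition of the relative entropy `R(q(x,·)‖K(x,·))`. -/
lemma toReal_relEnt_mhK [NeZero d] (hA : Assumptions πd Jd π) {x : S} {Q : Measure S}
    [IsProbabilityMeasure Q] {αm : S → Measure S} {ρ : ℝ} (hρ : 0 ≤ ρ)
    (hQ : Q = αm x + ENNReal.ofReal ρ • Measure.dirac x) (hα : αm x ≪ acc πd Jd x)
    (hfin : relEnt Q (mhK πd Jd x) ≠ ⊤) :
    (relEnt Q (mhK πd Jd x)).toReal =
        contPart πd Jd αm x + Real.log (ρ / rej πd Jd x) * ρ ∧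
      -1 ≤ contPart πd Jd αm x := by
  have := isProbabilityMeasure_mhK hA x
  have := isFiniteMeasure_acc hA x
  have := sigmaFinite_leb hA.measS
  have : IsFiniteMeasure (αm x) :=
    isFiniteMeasure_of_le Q (hQ ▸ Measure.le_add_right le_rfl)
  have hx : acc πd Jd x {x} = 0 :=
    withDensity_absolutelyContinuous _ _ (leb_singleton x hA.measS)
  obtain ⟨hac, hint, heq⟩ := toReal_relEnt hfin
  have hcont : contPart πd Jd αm x = ∫ y, llr (αm x) (acc πd Jd x) y ∂(αm x) :=
    integral_log_div_mul_eq_integral_llr ((measurable_accDens hA).comp measurable_prodMk_left)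
      (accDens_nonneg hA x) hα
  rw [heq, hcont]
  subst hQ
  obtain ⟨h1, h2⟩ := integral_llr_add_smul_dirac hα hx hρ (rej_mem_Icc hA x).1 hac hint
  refine ⟨h2, ?_⟩
  have h3 := InformationTheory.integral_llr_add_sub_measure_univ_nonneg hα h1
  have h4 : (acc πd Jd x).real univ ≤ 1 :=
    ENNReal.toReal_mono ENNReal.one_ne_top (acc_univ_le_one hA x)
  linarith [measureReal_nonneg (μ := αm x) (s := univ)]

section Subsingleton

variable [Subsingleton S]

lemma accDens_of_subsingleton (x y : S) :
    accDens πd Jd x y = Jd x y := by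
  obtain rfl := Subsingleton.elim x y
  unfold accDens hastingsRatio
  split_ifs with h
  · simp
  · simp [div_self h]

lemma rej_of_subsingleton (hA : Assumptions πd Jd π) (x : S) : rej πd Jd x = 0 := by
  have := hA.J_dens_prob x
  simp [rej, acc, accDens_of_subsingleton]

lemma eq_of_subsingleton (μ ν : Measure S) [IsProbabilityMeasure μ] [IsProbabilityMeasure ν] :
    μ = ν := by
  ext s _
  rcases s.eq_empty_or_nonempty with rfl | hs
  · simp
  · rw [Subsingleton.eq_univ_of_nonempty hs, measure_univ, measure_univ]

lemma contPart_nonpos_of_subsingleton (hA : Assumptions πd Jd π) {x : S} {Q : Measure S}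
    [IsProbabilityMeasure Q] {αm : S → Measure S} (hQ : αm x ≤ Q) :
    contPart πd Jd αm x ≤ 0 := by
  have := sigmaFinite_leb hA.measS
  have := isFiniteMeasure_of_le Q hQ
  have := hA.J_dens_prob x
  have hle : αm x ≤ (leb S).withDensity fun y => ENNReal.ofReal (Jd x y) :=
    hQ.trans_eq (eq_of_subsingleton _ _)
  have hae : (αm x).rnDeriv (leb S) ≤ᵐ[leb S] fun y => ENNReal.ofReal (Jd x y) := by
    refine ae_le_of_forall_setLIntegral_le_of_sigmaFinite (Measure.measurable_rnDeriv _ _)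
      fun s hs _ => ?_
    rw [← withDensity_apply (fun y => ENNReal.ofReal (Jd x y)) hs]
    exact (Measure.setLIntegral_rnDeriv_le s).trans (hle s)
  refine integral_nonpos_of_ae ?_
  filter_upwards [hae] with y hy
  rw [accDens_of_subsingleton]
  have h1 := ENNReal.toReal_le_of_le_ofReal (hA.J_nonneg x y) hy
  exact mul_nonpos_of_nonpos_of_nonneg (Real.log_nonpos (div_nonneg ENNReal.toReal_nonneg
    (hA.J_nonneg x y)) (div_le_one_of_le₀ h1 (hA.J_nonneg x y))) ENNReal.toReal_nonneg

end Subsingleton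

end MH

/-- **Explicit decomposition of the rate function (Proposition 4.3).** If `I(ν) < ∞` and
the minimizing kernel has the form `q(x,·) = α(x,·) + ρ(x) δ_x(·)` with
`α(x,·) ≪ a(x,·)` `ν`-a.s. and `ρ` measurable, then
`I(ν) = ∫∫ log(α(x,y)/a(x,y)) α(x,y) dy ν(dx) + ∫ log(ρ(x)/r(x)) ρ(x) ν(dx)`, where
`α(x,y)` denotes the Lebesgue density of `α(x,·)`. -/
theorem mh_rate_function_decomposition
    {d : ℕ} {S : Set (EuclideanSpace ℝ (Fin d))}
    (πd : S → ℝ) (Jd : S → S → ℝ) (π : Measure S) (hA : Assumptions πd Jd π)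
    (ν : Measure S) (hν : IsProbabilityMeasure ν)
    (hfin : rateI (mhK πd Jd) ν ≠ ⊤)
    (q : Kernel S S) (hq : IsMarkovKernel q) (hinv : Invariant ν (fun x => q x))
    (hopt : ∫⁻ x, relEnt (q x) (mhK πd Jd x) ∂ν = rateI (mhK πd Jd) ν)
    (αm : S → Measure S) (ρ : S → ℝ) (hρm : Measurable ρ)
    (hρ01 : ∀ x, ρ x ∈ Set.Icc (0 : ℝ) 1)
    (hform : ∀ᵐ x ∂ν, q x = αm x + ENNReal.ofReal (ρ x) • Measure.dirac x)
    (hαac : ∀ᵐ x ∂ν, αm x ≪ acc πd Jd x) :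
    rateI (mhK πd Jd) ν = ENNReal.ofReal
      ((∫ x, ∫ y, Real.log ((((αm x).rnDeriv (leb S) y).toReal) / accDens πd Jd x y) *
          ((αm x).rnDeriv (leb S) y).toReal ∂(leb S) ∂ν) +
        ∫ x, Real.log (ρ x / rej πd Jd x) * ρ x ∂ν) := by
  rcases Nat.eq_zero_or_pos d with rfl | hd
  · have hS : Subsingleton S := inferInstance
    have hzero : rateI (mhK πd Jd) ν = 0 := by
      rw [← hopt]
      refine (lintegral_congr fun x => ?_).trans lintegral_zero
      have := isProbabilityMeasure_mhK hA x
      rw [eq_of_subsingleton (q x) (mhK πd Jd x), relEnt_self]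
    rw [hzero, eq_comm, ENNReal.ofReal_eq_zero]
    simp only [rej_of_subsingleton hA, div_zero, Real.log_zero, zero_mul, integral_zero, add_zero]
    refine integral_nonpos_of_ae ?_
    filter_upwards [hform] with x hx
    exact contPart_nonpos_of_subsingleton hA (Q := q x) (hx ▸ Measure.le_add_right le_rfl)
  have : NeZero d := ⟨hd.ne'⟩
  let K : Kernel S S := ⟨mhK πd Jd, measurable_mhK hA⟩
  have : IsMarkovKernel K := ⟨isProbabilityMeasure_mhK hA⟩
  set R : S → ℝ≥0∞ := fun x => relEnt (q x) (mhK πd Jd x) with hR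
  set B : S → ℝ := fun x => Real.log (ρ x / rej πd Jd x) * ρ x with hB
  have hRm : Measurable R := measurable_relEnt q K
  have hRtop : ∫⁻ x, R x ∂ν ≠ ⊤ := hopt ▸ hfin
  have hRlt := ae_lt_top hRm hRtop
  have hRint : Integrable (fun x => (R x).toReal) ν :=
    integrable_toReal_of_lintegral_ne_top hRm.aemeasurable hRtop
  have hdec : ∀ᵐ x ∂ν, (R x).toReal = contPart πd Jd αm x + B x ∧
      -1 ≤ contPart πd Jd αm x := by
    filter_upwards [hform, hαac, hRlt] with x h1 h2 h3
    exact toReal_relEnt_mhK hA (hρ01 x).1 h1 h2 h3.ne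
  have hBm : Measurable B := (hρm.div (measurable_rej hA)).log.mul hρm
  have hBint : Integrable B ν := by
    refine Integrable.mono' (hRint.add (integrable_const 1)) hBm.aestronglyMeasurable ?_
    filter_upwards [hdec] with x hx
    have h1 : -1 ≤ B x := neg_one_le_log_div_mul (hρ01 x).1 (rej_mem_Icc hA x)
    have h2 : 0 ≤ (R x).toReal := ENNReal.toReal_nonneg
    rw [Real.norm_eq_abs, abs_le]
    simp only [Pi.add_apply]
    constructor <;> linarith [hx.1, hx.2]
  have hAB : ∫ x, contPart πd Jd αm x ∂ν = ∫ x, (R x).toReal ∂ν - ∫ x, B x ∂ν := by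
    rw [← integral_sub hRint hBint]
    refine integral_congr_ae ?_
    filter_upwards [hdec] with x hx
    linarith [hx.1]
  rw [hAB, sub_add_cancel, integral_toReal hRm.aemeasurable hRlt, ENNReal.ofReal_toReal hRtop, hopt]

end MHLDP
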